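/- Write L^{E,d}(x) = (A(E,x), B(E,x); C(E,x), D(E,x)) in d×d blocks. For every C₀ > 0 there exist E₀ > 0 and C₁ > 0 such that for every real E ≥ E₀, every x ∈ ℝ, and every K ∈ M_d(ℂ) with ‖K‖ ≤ C₀/E, the matrix A(E,x) + B(E,x)K is invertible and ‖(C(E,x) + D(E,x)K)·(A(E,x) + B(E,x)K)^{-1}‖ ≤ C₁/E. -/

import Mathlib

open scoped BigOperators Matrix

/-- The horizontal strip `S_h = {z : |Im z| < h}`. -/
def strip (h : ℝ) : Set ℂ := {z : ℂ | |z.im| < h}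

/-- The spectral (operator) norm of a rectangular complex matrix. -/
noncomputable def specNorm {m n : ℕ} (M : Matrix (Fin m) (Fin n) ℂ) : ℝ :=
  ‖LinearMap.toContinuousLinearMap (Matrix.toEuclideanLin M)‖

/-- Identification `Fin d ⊕ Fin d ≃ Fin (2d)`. -/
def sumEquiv (d : ℕ) : Fin d ⊕ Fin d ≃ Fin (2 * d) :=
  finSumFinEquiv.trans (finCongr (by omega))

/-- The upper-triangular matrix `C_d` with `(C_d)_{ij} = v̂_{d-(j-i)}` for `j ≥ i`. -/
noncomputable def Cdmat (d : ℕ) (vhat : ℤ → ℂ) : Matrix (Fin d) (Fin d) ℂ :=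
  Matrix.of fun i j => if (i : ℕ) ≤ (j : ℕ) then vhat ((d : ℤ) - ((j : ℤ) - (i : ℤ))) else 0

/-- The structure matrix `S_d = (0, -C_d*; C_d, 0)`. -/
noncomputable def Smat (d : ℕ) (vhat : ℤ → ℂ) : Matrix (Fin (2 * d)) (Fin (2 * d)) ℂ :=
  Matrix.reindex (sumEquiv d) (sumEquiv d)
    (Matrix.fromBlocks 0 (-(Cdmat d vhat)ᴴ) (Cdmat d vhat) 0)

/-- The standard symplectic matrix `𝒥_{2d} = (0, I_d; -I_d, 0)`. -/
noncomputable def Jmat (d : ℕ) : Matrix (Fin (2 * d)) (Fin (2 * d)) ℂ :=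
  Matrix.reindex (sumEquiv d) (sumEquiv d) (Matrix.fromBlocks 0 1 (-1) 0)

/-- The long-range transfer matrix `L^{E,d}(z)`. -/
noncomputable def Lmat (d : ℕ) (vhat : ℤ → ℂ) (E : ℂ) (z : ℂ) :
    Matrix (Fin (2 * d)) (Fin (2 * d)) ℂ :=
  Matrix.of fun r c =>
    if (r : ℕ) = 0 then
      (vhat d)⁻¹ *
        ((if (c : ℕ) = d - 1 then E - 2 * Complex.cos (2 * Real.pi * z) else 0)
          - vhat ((d : ℤ) - 1 - (c : ℤ)))
    else if (c : ℕ) + 1 = (r : ℕ) then 1 else 0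

/-- The dual potential matrix `V_d(x)`. -/
noncomputable def Vdmat (d : ℕ) (vhat : ℤ → ℂ) (α x : ℝ) : Matrix (Fin d) (Fin d) ℂ :=
  Matrix.of fun i j =>
    if i = j then 2 * Complex.cos (2 * Real.pi * ((x : ℂ) + (i : ℕ) * (α : ℂ)))
    else vhat ((i : ℤ) - (j : ℤ))

/-- The dual cocycle matrix `A^{E,d}(x) = (C_d⁻¹(E - V_d(x)), -C_d⁻¹C_d*; I, 0)`. -/
noncomputable def Amat (d : ℕ) (vhat : ℤ → ℂ) (α x : ℝ) (E : ℂ) :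
    Matrix (Fin (2 * d)) (Fin (2 * d)) ℂ :=
  Matrix.reindex (sumEquiv d) (sumEquiv d)
    (Matrix.fromBlocks
      ((Cdmat d vhat)⁻¹ * (E • (1 : Matrix (Fin d) (Fin d) ℂ) - Vdmat d vhat α x))
      (-((Cdmat d vhat)⁻¹ * (Cdmat d vhat)ᴴ))
      1 0)

lemma norm_entry_le_specNorm {m n : ℕ} (M : Matrix (Fin m) (Fin n) ℂ) (i : Fin m) (j : Fin n) :
    ‖M i j‖ ≤ specNorm M := by
  have h := (LinearMap.toContinuousLinearMap (Matrix.toEuclideanLin M)).le_opNorm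
    (EuclideanSpace.single j (1 : ℂ))
  have h' := PiLp.norm_apply_le
    (LinearMap.toContinuousLinearMap (Matrix.toEuclideanLin M) (EuclideanSpace.single j (1 : ℂ))) i
  simp only [PiLp.norm_single, norm_one, mul_one] at h
  have he : (LinearMap.toContinuousLinearMap (Matrix.toEuclideanLin M)
      (EuclideanSpace.single j (1 : ℂ))) i = M i j := by
    simp [Matrix.toLpLin_apply]
  rw [he] at h'
  exact h'.trans h

lemma euclideanSpace_norm_le_sum_norm {n : ℕ} (y : EuclideanSpace ℂ (Fin n)) :
    ‖y‖ ≤ ∑ i, ‖y i‖ := by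
  rw [EuclideanSpace.norm_eq]
  refine Real.sqrt_le_iff.2 ⟨by positivity, ?_⟩
  exact Finset.sum_sq_le_sq_sum_of_nonneg fun i _ => norm_nonneg _

lemma specNorm_le_of_norm_entry_le {m n : ℕ} {M : Matrix (Fin m) (Fin n) ℂ} {c : ℝ}
    (hc : 0 ≤ c) (h : ∀ i j, ‖M i j‖ ≤ c) : specNorm M ≤ m * (n * c) := by
  refine ContinuousLinearMap.opNorm_le_bound _ (by positivity) fun y => ?_
  refine (euclideanSpace_norm_le_sum_norm _).trans ?_
  have hrow : ∀ i, ‖(LinearMap.toContinuousLinearMap (Matrix.toEuclideanLin M) y) i‖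
      ≤ n * c * ‖y‖ := by
    intro i
    have he : (LinearMap.toContinuousLinearMap (Matrix.toEuclideanLin M) y) i
        = ∑ j, M i j * y j := by
      simp [Matrix.toLpLin_apply, Matrix.mulVec, dotProduct]
    rw [he]
    refine (norm_sum_le_of_le (f := fun j => M i j * y j) (n := fun _ => c * ‖y‖) _
      fun j _ => ?_).trans ?_
    · rw [norm_mul]
      exact mul_le_mul (h i j) (PiLp.norm_apply_le y j) (norm_nonneg _) hc
    · simp [mul_assoc]
  refine (Finset.sum_le_sum fun i _ => hrow i).trans ?_
  simp [mul_assoc]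

/-- The companion-type matrix with first row `r` and ones on the subdiagonal. -/
def companionRow {n : ℕ} (r : Fin (n + 1) → ℂ) : Matrix (Fin (n + 1)) (Fin (n + 1)) ℂ :=
  Matrix.of (Fin.cons r fun i : Fin n => Pi.single i.castSucc 1)

/-- The inverse of `companionRow r` when the last entry of `r` is nonzero. -/
noncomputable def companionRowInv {n : ℕ} (r : Fin (n + 1) → ℂ) :
    Matrix (Fin (n + 1)) (Fin (n + 1)) ℂ :=
  Matrix.of (Fin.snoc (α := fun _ => Fin (n + 1) → ℂ)
    (fun i : Fin n => Pi.single i.succ 1)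
    (Fin.cons (r (Fin.last n))⁻¹ fun j : Fin n => -r j.castSucc * (r (Fin.last n))⁻¹))

lemma companionRow_mul_inv {n : ℕ} (r : Fin (n + 1) → ℂ) (hr : r (Fin.last n) ≠ 0) :
    companionRow r * companionRowInv r = 1 := by
  ext i j
  rw [Matrix.mul_apply, Fin.sum_univ_castSucc]
  refine Fin.cases ?_ (fun i => ?_) i <;> refine Fin.cases ?_ (fun j => ?_) j
  · simp [companionRow, companionRowInv, hr, (Fin.succ_ne_zero _).symm]
  · simp [companionRow, companionRowInv, Pi.single_apply, (Fin.succ_ne_zero _).symm]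
    field_simp
    simp
  · simp [companionRow, companionRowInv, Pi.single_apply, (Fin.succ_ne_zero _).symm,
      (Fin.castSucc_ne_last _).symm]
  · simp [companionRow, companionRowInv, Pi.single_apply, Matrix.one_apply,
      (Fin.castSucc_ne_last _).symm, eq_comm]

lemma norm_companionRowInv_last_le {n : ℕ} (r : Fin (n + 1) → ℂ) {R : ℝ}
    (hR : ∀ j : Fin n, ‖r j.castSucc‖ ≤ R) (hR0 : 0 ≤ R) (j : Fin (n + 1)) :
    ‖companionRowInv r (Fin.last n) j‖ ≤ (1 + R) * ‖r (Fin.last n)‖⁻¹ := by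
  have h0 : 0 ≤ ‖r (Fin.last n)‖⁻¹ := by positivity
  refine Fin.cases ?_ (fun j => ?_) j
  · simp only [companionRowInv, Matrix.of_apply, Fin.snoc_last, Fin.cons_zero, norm_inv]
    nlinarith
  · simp only [companionRowInv, Matrix.of_apply, Fin.snoc_last, Fin.cons_succ, norm_inv,
      norm_mul, norm_neg]
    nlinarith [hR j]

lemma norm_companionRowInv_castSucc_le {n : ℕ} (r : Fin (n + 1) → ℂ) (i : Fin n)
    (j : Fin (n + 1)) : ‖companionRowInv r i.castSucc j‖ ≤ 1 := by
  simp only [companionRowInv, Matrix.of_apply, Fin.snoc_castSucc, Pi.single_apply]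
  split_ifs <;> simp

/-- The first row of `A + B K`. -/
noncomputable def upperRow (n : ℕ) (vhat : ℤ → ℂ) (E x : ℝ)
    (K : Matrix (Fin (n + 1)) (Fin (n + 1)) ℂ) (j : Fin (n + 1)) : ℂ :=
  (vhat (n + 1 : ℕ))⁻¹ * ((if j = Fin.last n then
      (E : ℂ) - 2 * Complex.cos (2 * Real.pi * x) else 0)
    - vhat ((n : ℤ) - j) - ∑ k : Fin (n + 1), vhat (-1 - k) * K k j)

lemma sumEquiv_inl_val (d : ℕ) (i : Fin d) : (sumEquiv d (Sum.inl i) : ℕ) = i := by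
  simp [sumEquiv]

lemma sumEquiv_inr_val (d : ℕ) (i : Fin d) : (sumEquiv d (Sum.inr i) : ℕ) = d + i := by
  simp [sumEquiv, add_comm]

lemma Lmat_apply_of_val_eq_zero {d : ℕ} (vhat : ℤ → ℂ) (E z : ℂ) {r : Fin (2 * d)}
    (hr : (r : ℕ) = 0) (c : Fin (2 * d)) :
    Lmat d vhat E z r c = (vhat d)⁻¹ *
      ((if (c : ℕ) = d - 1 then E - 2 * Complex.cos (2 * Real.pi * z) else 0)
        - vhat ((d : ℤ) - 1 - (c : ℤ))) := by
  rw [Lmat, Matrix.of_apply, if_pos hr]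

lemma Lmat_apply_of_val_ne_zero {d : ℕ} (vhat : ℤ → ℂ) (E z : ℂ) {r : Fin (2 * d)}
    (hr : (r : ℕ) ≠ 0) (c : Fin (2 * d)) :
    Lmat d vhat E z r c = if (c : ℕ) + 1 = (r : ℕ) then 1 else 0 := by
  rw [Lmat, Matrix.of_apply, if_neg hr]

lemma upper_block_eq_companionRow (n : ℕ) (vhat : ℤ → ℂ) (E x : ℝ)
    (K : Matrix (Fin (n + 1)) (Fin (n + 1)) ℂ) :
    ((Lmat (n + 1) vhat (E : ℂ) (x : ℂ)).submatrix
        (sumEquiv (n + 1)) (sumEquiv (n + 1))).toBlocks₁₁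
      + ((Lmat (n + 1) vhat (E : ℂ) (x : ℂ)).submatrix
        (sumEquiv (n + 1)) (sumEquiv (n + 1))).toBlocks₁₂ * K
      = companionRow (upperRow n vhat E x K) := by
  ext i j
  rw [Matrix.add_apply, Matrix.mul_apply]
  simp only [Matrix.toBlocks₁₁, Matrix.toBlocks₁₂, Matrix.of_apply, Matrix.submatrix_apply]
  refine Fin.cases ?_ (fun i => ?_) i
  · have hr : (sumEquiv (n + 1) (Sum.inl 0) : ℕ) = 0 := sumEquiv_inl_val _ _
    have h1 : ∀ k : Fin (n + 1), ¬ (n + 1 + (k : ℕ) = n + 1 - 1) := fun k => by omega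
    have h2 : ∀ k : Fin (n + 1), ((n + 1 : ℕ) : ℤ) - 1 - ((n + 1 + k : ℕ) : ℤ) = -1 - k :=
      fun k => by push_cast; ring
    have h3 : ((n + 1 : ℕ) : ℤ) - 1 - (j : ℤ) = n - j := by push_cast; ring
    have h4 : (j : ℕ) = n + 1 - 1 ↔ j = Fin.last n := by simp [Fin.ext_iff]
    simp only [Lmat_apply_of_val_eq_zero _ _ _ hr, sumEquiv_inl_val, sumEquiv_inr_val, h1, h2, h3,
      h4, if_false, companionRow, upperRow, Matrix.of_apply, Fin.cons_zero]
    rw [mul_sub _ _ (∑ k, _), sub_eq_add_neg _ (_ * ∑ k, _), Finset.mul_sum,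
      ← Finset.sum_neg_distrib]
    congr 1
    exact Finset.sum_congr rfl fun k _ => by ring
  · have hr : (sumEquiv (n + 1) (Sum.inl i.succ) : ℕ) ≠ 0 := by simp [sumEquiv_inl_val]
    have h1 : ∀ k : Fin (n + 1), ¬ (n + 1 + (k : ℕ) = i) := fun k => by omega
    simp [Lmat_apply_of_val_ne_zero _ _ _ hr, sumEquiv_inl_val, sumEquiv_inr_val, h1,
      companionRow, Fin.ext_iff, Pi.single_apply]

lemma lower_block_eq (n : ℕ) (vhat : ℤ → ℂ) (E x : ℝ)
    (K : Matrix (Fin (n + 1)) (Fin (n + 1)) ℂ) :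
    ((Lmat (n + 1) vhat (E : ℂ) (x : ℂ)).submatrix
        (sumEquiv (n + 1)) (sumEquiv (n + 1))).toBlocks₂₁
      + ((Lmat (n + 1) vhat (E : ℂ) (x : ℂ)).submatrix
        (sumEquiv (n + 1)) (sumEquiv (n + 1))).toBlocks₂₂ * K
      = Matrix.of (Fin.cons (Pi.single (Fin.last n) 1) fun i : Fin n => K i.castSucc) := by
  ext i j
  have hr : ∀ i, (sumEquiv (n + 1) (Sum.inr i) : ℕ) ≠ 0 := fun i => by
    rw [sumEquiv_inr_val]; omega
  rw [Matrix.add_apply, Matrix.mul_apply]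
  simp only [Matrix.toBlocks₂₁, Matrix.toBlocks₂₂, Matrix.of_apply, Matrix.submatrix_apply,
    Lmat_apply_of_val_ne_zero _ _ _ (hr _), sumEquiv_inl_val, sumEquiv_inr_val]
  refine Fin.cases ?_ (fun i => ?_) i
  · have h1 : ∀ k : Fin (n + 1), ¬ (n + 1 + (k : ℕ) = n) := fun k => by omega
    simp [h1, Fin.ext_iff, Pi.single_apply]
  · have h1 : ¬ ((j : ℕ) + 1 = n + 1 + (i.succ : ℕ)) := by simp; omega
    have h2 : ∀ k : Fin (n + 1), n + 1 + (k : ℕ) + 1 = n + 1 + (i.succ : ℕ) ↔ k = i.castSucc :=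
      fun k => by simp [Fin.ext_iff]; omega
    simp only [h1, h2]
    simp

lemma norm_lower_mul_le {n : ℕ} (K N : Matrix (Fin (n + 1)) (Fin (n + 1)) ℂ) {k b l : ℝ}
    (hk : ∀ i j, ‖K i j‖ ≤ k) (hN : ∀ i j, ‖N i j‖ ≤ b) (hl : ∀ j, ‖N (Fin.last n) j‖ ≤ l)
    (i j : Fin (n + 1)) :
    ‖((Matrix.of (Fin.cons (Pi.single (Fin.last n) 1) fun i : Fin n => K i.castSucc) :
      Matrix (Fin (n + 1)) (Fin (n + 1)) ℂ) * N) i j‖ ≤ l + (n + 1) * (k * b) := by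
  have hk0 : 0 ≤ k := (norm_nonneg _).trans (hk 0 0)
  have hb0 : 0 ≤ b := (norm_nonneg _).trans (hN 0 0)
  have hl0 : 0 ≤ l := (norm_nonneg _).trans (hl 0)
  rw [Matrix.mul_apply]
  refine Fin.cases ?_ (fun i => ?_) i
  · simp only [Matrix.of_apply, Fin.cons_zero, Pi.single_apply, ite_mul, one_mul, zero_mul,
      Finset.sum_ite_eq', Finset.mem_univ, if_true]
    have := hl j
    have : 0 ≤ ((n : ℝ) + 1) * (k * b) := by positivity
    linarith
  · simp only [Matrix.of_apply, Fin.cons_succ]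
    refine (norm_sum_le_of_le (n := fun _ => k * b) _ fun m _ => ?_).trans ?_
    · rw [norm_mul]
      exact mul_le_mul (hk _ _) (hN _ _) (norm_nonneg _) hk0
    · simp [hl0]

lemma norm_couplings_le (n : ℕ) (vhat : ℤ → ℂ) {V k : ℝ}
    (hV : ∀ m, |m| ≤ (n : ℤ) + 1 → ‖vhat m‖ ≤ V)
    {K : Matrix (Fin (n + 1)) (Fin (n + 1)) ℂ} (hK : ∀ i j, ‖K i j‖ ≤ k) (j : Fin (n + 1)) :
    ‖vhat ((n : ℤ) - j) + ∑ k : Fin (n + 1), vhat (-1 - k) * K k j‖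
      ≤ V * (1 + (n + 1) * k) := by
  have hV0 : 0 ≤ V := (norm_nonneg _).trans (hV 0 (by simp; omega))
  have h1 : ‖vhat ((n : ℤ) - j)‖ ≤ V := hV _ (by rw [abs_le]; omega)
  have h2 : ‖∑ k : Fin (n + 1), vhat (-1 - k) * K k j‖ ≤ (n + 1) * (V * k) := by
    refine (norm_sum_le_of_le (n := fun _ => V * k) _ fun m _ => ?_).trans ?_
    · rw [norm_mul]
      exact mul_le_mul (hV _ (by rw [abs_le]; omega)) (hK _ _) (norm_nonneg _) hV0
    · simp
  refine (norm_add_le _ _).trans ?_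
  linarith

lemma norm_upperRow_castSucc_le {n : ℕ} {vhat : ℤ → ℂ} {V k : ℝ}
    (hV : ∀ m, |m| ≤ (n : ℤ) + 1 → ‖vhat m‖ ≤ V) (E x : ℝ)
    {K : Matrix (Fin (n + 1)) (Fin (n + 1)) ℂ} (hK : ∀ i j, ‖K i j‖ ≤ k) (j : Fin n) :
    ‖upperRow n vhat E x K j.castSucc‖
      ≤ ‖vhat (n + 1 : ℕ)‖⁻¹ * (V * (1 + (n + 1) * k)) := by
  rw [upperRow, if_neg (Fin.castSucc_ne_last j), zero_sub, ← neg_add', norm_mul, norm_neg, norm_inv]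
  exact mul_le_mul_of_nonneg_left (norm_couplings_le n vhat hV hK _) (by positivity)

lemma le_norm_upperRow_last {n : ℕ} {vhat : ℤ → ℂ} {V k : ℝ}
    (hV : ∀ m, |m| ≤ (n : ℤ) + 1 → ‖vhat m‖ ≤ V) (E x : ℝ)
    {K : Matrix (Fin (n + 1)) (Fin (n + 1)) ℂ} (hK : ∀ i j, ‖K i j‖ ≤ k) :
    ‖vhat (n + 1 : ℕ)‖⁻¹ * (E - 2 - V * (1 + (n + 1) * k))
      ≤ ‖upperRow n vhat E x K (Fin.last n)‖ := by
  rw [upperRow, if_pos rfl, sub_sub _ (vhat _), norm_mul, norm_inv]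
  refine mul_le_mul_of_nonneg_left ?_ (by positivity)
  have hc := norm_couplings_le n vhat hV hK (Fin.last n)
  have hE : E - 2 ≤ ‖(E : ℂ) - 2 * Complex.cos (2 * Real.pi * x)‖ := by
    have he : (E : ℂ) - 2 * Complex.cos (2 * Real.pi * x)
        = ((E - 2 * Real.cos (2 * Real.pi * x) : ℝ) : ℂ) := by push_cast; rfl
    rw [he, Complex.norm_real, Real.norm_eq_abs]
    refine le_trans ?_ (le_abs_self _)
    linarith [Real.cos_le_one (2 * Real.pi * x)]
  refine le_trans ?_ (norm_sub_norm_le _ _)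
  linarith

lemma exists_norm_le_of_abs_le (vhat : ℤ → ℂ) (m : ℤ) :
    ∃ V : ℝ, ∀ k, |k| ≤ m → ‖vhat k‖ ≤ V :=
  ⟨∑ k ∈ Finset.Icc (-m) m, ‖vhat k‖, fun k hk =>
    Finset.single_le_sum (f := fun k => ‖vhat k‖) (fun _ _ => norm_nonneg _)
      (Finset.mem_Icc.2 (abs_le.1 hk))⟩

/-- Stability of the horizontal cone at large energy: writing
`L^{E,d}(x) = (A, B; C, D)` in `d×d` blocks, for every `C₀ > 0` there are `E₀, C₁ > 0`
such that for `E ≥ E₀`, any `x`, and any `K` with `‖K‖ ≤ C₀/E`, the matrix `A + BK`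
is invertible and `‖(C + DK)(A + BK)⁻¹‖ ≤ C₁/E`. -/
theorem cone_stability_large_energy
    (d : ℕ) (hd : 1 ≤ d)
    (vhat : ℤ → ℂ) (hv : ∀ k : ℤ, vhat (-k) = starRingEnd ℂ (vhat k))
    (hvd : vhat (d : ℤ) ≠ 0) :
    ∀ C₀ > (0 : ℝ), ∃ E₀ > (0 : ℝ), ∃ C₁ > (0 : ℝ),
      ∀ E : ℝ, E₀ ≤ E → ∀ x : ℝ, ∀ K : Matrix (Fin d) (Fin d) ℂ,
        specNorm K ≤ C₀ / E →
        IsUnit ((((Lmat d vhat (E : ℂ) (x : ℂ)).submatrix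
              (sumEquiv d) (sumEquiv d)).toBlocks₁₁
            + ((Lmat d vhat (E : ℂ) (x : ℂ)).submatrix
              (sumEquiv d) (sumEquiv d)).toBlocks₁₂ * K)) ∧
        specNorm
          ((((Lmat d vhat (E : ℂ) (x : ℂ)).submatrix
                (sumEquiv d) (sumEquiv d)).toBlocks₂₁
              + ((Lmat d vhat (E : ℂ) (x : ℂ)).submatrix
                (sumEquiv d) (sumEquiv d)).toBlocks₂₂ * K) *
            (((Lmat d vhat (E : ℂ) (x : ℂ)).submatrix
                (sumEquiv d) (sumEquiv d)).toBlocks₁₁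
              + ((Lmat d vhat (E : ℂ) (x : ℂ)).submatrix
                (sumEquiv d) (sumEquiv d)).toBlocks₁₂ * K)⁻¹)
          ≤ C₁ / E := by
  obtain ⟨n, rfl⟩ : ∃ n, d = n + 1 := ⟨d - 1, by omega⟩
  intro C₀ hC₀
  obtain ⟨V, hV⟩ := exists_norm_le_of_abs_le vhat ((n : ℤ) + 1)
  have hV0 : 0 ≤ V := (norm_nonneg _).trans (hV 0 (by simp; omega))
  set a : ℝ := ‖vhat (n + 1 : ℕ)‖⁻¹ with ha_def
  have ha : 0 < a := inv_pos.2 (norm_pos_iff.2 hvd)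
  set Q : ℝ := V * (1 + (n + 1) * C₀) with hQ_def
  have hQ : 0 ≤ Q := by positivity
  set T : ℝ := (1 + a * Q) * (2 / a) with hT_def
  have hT : 0 < T := by positivity
  refine ⟨4 + 2 * Q, by positivity,
    (n + 1) * ((n + 1) * (T + (n + 1) * (C₀ * (1 + T)))), by positivity, ?_⟩
  intro E hE x K hK
  have hE1 : 1 ≤ E := by linarith
  have hE0 : 0 < E := by linarith
  have hKe : ∀ i j, ‖K i j‖ ≤ C₀ / E := fun i j => (norm_entry_le_specNorm K i j).trans hK
  have hKe' : ∀ i j, ‖K i j‖ ≤ C₀ := fun i j => (hKe i j).trans (div_le_self hC₀.le hE1)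
  rw [upper_block_eq_companionRow, lower_block_eq]
  set r := upperRow n vhat E x K
  have hrl : a * (E / 2) ≤ ‖r (Fin.last n)‖ :=
    (mul_le_mul_of_nonneg_left (by linarith) ha.le).trans (le_norm_upperRow_last hV E x hKe')
  have hr0 : 0 < ‖r (Fin.last n)‖ := lt_of_lt_of_le (by positivity) hrl
  have hmul := companionRow_mul_inv r (norm_pos_iff.1 hr0)
  refine ⟨IsUnit.of_mul_eq_one _ hmul, ?_⟩
  rw [Matrix.inv_eq_right_inv hmul]
  have hlast : ∀ j, ‖companionRowInv r (Fin.last n) j‖ ≤ T / E := by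
    intro j
    refine (norm_companionRowInv_last_le r (norm_upperRow_castSucc_le hV E x hKe')
      (by positivity) j).trans ?_
    calc (1 + a * Q) * ‖r (Fin.last n)‖⁻¹ ≤ (1 + a * Q) * (a * (E / 2))⁻¹ := by gcongr
      _ = T / E := by rw [hT_def]; field_simp
  have hN : ∀ i j, ‖companionRowInv r i j‖ ≤ 1 + T := by
    intro i j
    refine Fin.lastCases ?_ (fun i => ?_) i
    · linarith [hlast j, div_le_self hT.le hE1]
    · linarith [norm_companionRowInv_castSucc_le r i j]
  refine (specNorm_le_of_norm_entry_le (by positivity)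
    (norm_lower_mul_le K _ hKe hN hlast)).trans (le_of_eq ?_)
  push_cast
  field_simp
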